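/- arXiv:1403.3901 — 2 statements merged into one kernel-verified Lean document; each statement's English description precedes it below -/
import Mathlib

section
/- For all real values of λ and ε₁, the Lie–Poisson bracket of F₁ and F₂ equals F₀: the identity {F₁,F₂} = F₀ holds at every point of ℝ⁹. -/
noncomputable section

/-- The phase space `ℝ⁹` with coordinates `(M₁,M₂,M₃,α₁,α₂,α₃,β₁,β₂,β₃)`. -/
abbrev V9 : Type := Fin 9 → ℝ

/-- Index of `M_i` among the nine coordinates. -/
def mIdx (i : Fin 3) : Fin 9 := ⟨i.1, by have := i.isLt; omega⟩
/-- Index of `α_i` among the nine coordinates. -/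
def aIdx (i : Fin 3) : Fin 9 := ⟨i.1 + 3, by have := i.isLt; omega⟩
/-- Index of `β_i` among the nine coordinates. -/
def bIdx (i : Fin 3) : Fin 9 := ⟨i.1 + 6, by have := i.isLt; omega⟩

/-- The Levi-Civita symbol `ε_{ijk} = ½(i−j)(j−k)(k−i)`. -/
def epsSym (i j k : Fin 3) : ℝ :=
  (((i.1 : ℝ) - (j.1 : ℝ)) * ((j.1 : ℝ) - (k.1 : ℝ)) * ((k.1 : ℝ) - (i.1 : ℝ))) / 2

/-- Partial derivative of `f : ℝ⁹ → ℝ` in the `i`-th coordinate direction. -/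
def pd (i : Fin 9) (f : V9 → ℝ) (x : V9) : ℝ := fderiv ℝ f x (Pi.single i 1)

/-- The Lie–Poisson bracket of the Lie coalgebra `e(3,2)*`. -/
def pb (f g : V9 → ℝ) (x : V9) : ℝ :=
  ∑ i : Fin 3, ∑ j : Fin 3, ∑ k : Fin 3, epsSym i j k *
    (pd (mIdx i) f x * pd (mIdx j) g x * x (mIdx k)
      + (pd (mIdx i) f x * pd (aIdx j) g x - pd (mIdx i) g x * pd (aIdx j) f x) * x (aIdx k)
      + (pd (mIdx i) f x * pd (bIdx j) g x - pd (mIdx i) g x * pd (bIdx j) f x) * x (bIdx k))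

/-- The invariant relation `F₁ = M₃ + λ + ε₁(β₁ − α₂)`. -/
def F1 (lam e1 : ℝ) : V9 → ℝ := fun x => x 2 + lam + e1 * (x 6 - x 4)

/-- The invariant relation `F₂`. -/
def F2 (lam e1 : ℝ) : V9 → ℝ := fun x =>
  x 2 ^ 3 + (e1 * (x 6 - x 4) + lam) * x 2 ^ 2
    + (x 0 ^ 2 + x 1 ^ 2 + 2 * e1 * (x 5 * x 1 - x 8 * x 0)) * x 2
    + e1 * ((x 1 ^ 2 - x 0 ^ 2) * (x 4 + x 6) + 2 * x 0 * x 1 * (x 3 - x 7))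
    + lam * (x 0 ^ 2 + x 1 ^ 2)

/-- The first integral `F₀` of the critical subsystem `M_{L₁}`. -/
def F0 (lam e1 : ℝ) : V9 → ℝ := fun x =>
  2 * e1 * (-(x 3 + x 7) * x 2 ^ 2 - (x 3 + x 7) * (e1 * (x 6 - x 4) + lam) * x 2
    - x 3 * x 0 ^ 2 - x 7 * x 1 ^ 2 - (x 4 + x 6) * x 0 * x 1
    + (e1 * (2 * x 3 * x 8 - x 6 * x 5 - x 4 * x 5) + lam * x 5) * x 0
    - (e1 * (2 * x 7 * x 5 - x 6 * x 8 - x 4 * x 8) - lam * x 8) * x 1)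

theorem pd_apply (i j : Fin 9) (x : V9) :
    pd i (fun y => y j) x = if j = i then 1 else 0 := by
  rw [pd, (hasFDerivAt_apply j x).fderiv]
  simp [Pi.single_apply]

theorem pd_const (i : Fin 9) (c : ℝ) (x : V9) : pd i (fun _ => c) x = 0 := by
  simp [pd]

theorem pd_add (i : Fin 9) {f g : V9 → ℝ} {x : V9} (hf : DifferentiableAt ℝ f x)
    (hg : DifferentiableAt ℝ g x) :
    pd i (fun y => f y + g y) x = pd i f x + pd i g x := by
  simp [pd, fderiv_fun_add hf hg]

theorem pd_sub (i : Fin 9) {f g : V9 → ℝ} {x : V9} (hf : DifferentiableAt ℝ f x)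
    (hg : DifferentiableAt ℝ g x) :
    pd i (fun y => f y - g y) x = pd i f x - pd i g x := by
  simp [pd, fderiv_fun_sub hf hg]

theorem pd_mul (i : Fin 9) {f g : V9 → ℝ} {x : V9} (hf : DifferentiableAt ℝ f x)
    (hg : DifferentiableAt ℝ g x) :
    pd i (fun y => f y * g y) x = f x * pd i g x + g x * pd i f x := by
  simp [pd, fderiv_fun_mul hf hg]

theorem pd_pow (i : Fin 9) (n : ℕ) {f : V9 → ℝ} {x : V9} (hf : DifferentiableAt ℝ f x) :
    pd i (fun y => f y ^ n) x = n * f x ^ (n - 1) * pd i f x := by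
  simp [pd, fderiv_fun_pow n hf]

theorem pd_F1 (lam e1 : ℝ) (i : Fin 9) (x : V9) :
    pd i (F1 lam e1) x = ![0, 0, 1, 0, -e1, 0, e1, 0, 0] i := by
  unfold F1
  simp (disch := fun_prop) only [pd_add, pd_sub, pd_mul, pd_const, pd_apply]
  fin_cases i <;> simp

theorem pd_F2 (lam e1 : ℝ) (i : Fin 9) (x : V9) :
    pd i (F2 lam e1) x =
      ![2 * x 0 * x 2 - 2 * e1 * x 8 * x 2 - 2 * e1 * x 0 * (x 4 + x 6)
          + 2 * e1 * x 1 * (x 3 - x 7) + 2 * lam * x 0,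
        2 * x 1 * x 2 + 2 * e1 * x 5 * x 2 + 2 * e1 * x 1 * (x 4 + x 6)
          + 2 * e1 * x 0 * (x 3 - x 7) + 2 * lam * x 1,
        3 * x 2 ^ 2 + 2 * (e1 * (x 6 - x 4) + lam) * x 2
          + (x 0 ^ 2 + x 1 ^ 2 + 2 * e1 * (x 5 * x 1 - x 8 * x 0)),
        2 * e1 * x 0 * x 1,
        -e1 * x 2 ^ 2 + e1 * (x 1 ^ 2 - x 0 ^ 2),
        2 * e1 * x 1 * x 2,
        e1 * x 2 ^ 2 + e1 * (x 1 ^ 2 - x 0 ^ 2),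
        -2 * e1 * x 0 * x 1,
        -2 * e1 * x 0 * x 2] i := by
  unfold F2
  simp (disch := fun_prop) only [pd_add, pd_sub, pd_mul, pd_pow, pd_const, pd_apply]
  fin_cases i <;> simp <;> ring

/-- The Lie–Poisson bracket of `F₁` and `F₂` equals `F₀` at every point. -/
theorem bracket_F1_F2 (lam e1 : ℝ) (x : V9) :
    pb (F1 lam e1) (F2 lam e1) x = F0 lam e1 x := by
  simp only [pb, pd_F1, pd_F2, Fin.sum_univ_three]
  simp [mIdx, aIdx, bIdx, epsSym, F0]
  ring
end
end

section
/- For ε₂ = 0, the derivative of M₁ in virtue of the equations of motion satisfies {H,M₁} = −2ε₁β₂M₁ + [2M₃ + 2λ + 2ε₁(β₁−α₂) + 2ε₁α₂]M₂ at every point of ℝ⁹, for all real values of λ and ε₁. -/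
noncomputable section

/-- The Hamiltonian `H` of the generalized two-field gyrostat. -/
def Hfun (lam e1 e2 : ℝ) : V9 → ℝ := fun x =>
  x 0 ^ 2 + x 1 ^ 2 + 2 * x 2 ^ 2 + 2 * lam * x 2 - 2 * e2 * (x 3 + x 7)
    + 2 * e1 * (x 1 * x 5 - x 2 * x 4 + x 2 * x 6 - x 0 * x 8)

/-- The partial derivatives of a coordinate function. -/
lemma pd_coord (i j : Fin 9) (x : V9) :
    pd i (fun y => y j) x = (Pi.single i 1 : V9) j := by
  rw [pd, (hasFDerivAt_apply (𝕜 := ℝ) j x).fderiv]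
  rfl

/-- The partial derivatives of the Hamiltonian, for `ε₂ = 0`. -/
lemma pd_Hfun (lam e1 : ℝ) (i : Fin 9) (x : V9) :
    pd i (Hfun lam e1 0) x =
      ![2 * x 0 - 2 * e1 * x 8, 2 * x 1 + 2 * e1 * x 5,
        4 * x 2 + 2 * lam + 2 * e1 * (x 6 - x 4), 0, -(2 * e1 * x 2), 2 * e1 * x 1,
        2 * e1 * x 2, 0, -(2 * e1 * x 0)] i := by
  have c (j : Fin 9) := hasFDerivAt_apply (𝕜 := ℝ) j x
  have h := ((((((c 0).pow 2).add ((c 1).pow 2)).add (((c 2).pow 2).const_mul 2)).add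
    ((c 2).const_mul (2 * lam))).sub (((c 3).add (c 7)).const_mul (2 * 0))).add
    ((((((c 1).mul (c 5)).sub ((c 2).mul (c 4))).add ((c 2).mul (c 6))).sub
      ((c 0).mul (c 8))).const_mul (2 * e1))
  have h' : fderiv ℝ (Hfun lam e1 0) x = _ := HasFDerivAt.fderiv h
  rw [pd, h']
  fin_cases i <;> simp <;> ring

/-- For `ε₂ = 0`, `{H, M₁} = −2ε₁β₂M₁ + [2M₃ + 2λ + 2ε₁(β₁−α₂) + 2ε₁α₂]M₂` everywhere. -/
theorem bracket_H_M1 (lam e1 : ℝ) (x : V9) :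
    pb (Hfun lam e1 0) (fun y => y 0) x
      = -(2 * e1 * x 7) * x 0
        + (2 * x 2 + 2 * lam + 2 * e1 * (x 6 - x 4) + 2 * e1 * x 4) * x 1 := by
  simp only [pb, pd_coord, pd_Hfun, Fin.sum_univ_three]
  simp [epsSym, mIdx, aIdx, bIdx]
  ring
end
end
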